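/- With the clock construction of the trihex from a closed 4-bar triple: for every A, B, C ∈ ℝ² with ‖A‖ = ‖B‖ = ‖C‖ = 1 and A + B + C = RP − P, all twelve bars have unit length; that is, ‖x₁ − P‖ = ‖x₂ − x₁‖ = ‖RP − x₂‖ = ‖x₃ − RP‖ = ‖x₄ − x₃‖ = ‖R²P − x₄‖ = ‖x₅ − R²P‖ = ‖x₆ − x₅‖ = ‖P − x₆‖ = ‖x₃ − x₂‖ = ‖x₅ − x₄‖ = ‖x₁ − x₆‖ = 1. In particular every solution of the single 4-bar closure equation extends, by 120° rotational symmetry, to a realization of the trihex with equilateral pinned triangle and all bars of unit length. -/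

import Mathlib

noncomputable section

/-- The Euclidean plane ℝ². -/
abbrev Plane := EuclideanSpace ℝ (Fin 2)

/-- The rotation of the plane about the origin by 120°. -/
noncomputable def rot120 (v : Plane) : Plane :=
  (WithLp.equiv 2 (Fin 2 → ℝ)).symm
    ![-(v 0) / 2 - Real.sqrt 3 / 2 * v 1, Real.sqrt 3 / 2 * v 0 - v 1 / 2]

theorem rot120_apply_zero (v : Plane) : rot120 v 0 = -(v 0) / 2 - Real.sqrt 3 / 2 * v 1 := rfl

theorem rot120_apply_one (v : Plane) : rot120 v 1 = Real.sqrt 3 / 2 * v 0 - v 1 / 2 := rfl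

theorem rot120_add (u v : Plane) : rot120 (u + v) = rot120 u + rot120 v := by
  ext i
  fin_cases i <;> simp [rot120_apply_zero, rot120_apply_one] <;> ring

theorem rot120_rot120 (v : Plane) : rot120 (rot120 v) = -v - rot120 v := by
  have h : Real.sqrt 3 * Real.sqrt 3 = 3 := Real.mul_self_sqrt (by norm_num)
  ext i
  fin_cases i <;> simp [rot120_apply_zero, rot120_apply_one]
  · linear_combination (-(v 0) / 4) * h
  · linear_combination (-(v 1) / 4) * h

theorem norm_rot120 (v : Plane) : ‖rot120 v‖ = ‖v‖ := by
  have h : Real.sqrt 3 * Real.sqrt 3 = 3 := Real.mul_self_sqrt (by norm_num)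
  rw [EuclideanSpace.norm_eq, EuclideanSpace.norm_eq]
  congr 1
  simp only [Fin.sum_univ_two, Real.norm_eq_abs, sq_abs, rot120_apply_zero, rot120_apply_one]
  linear_combination ((v 0 ^ 2 + v 1 ^ 2) / 4) * h

/-- The clock construction of the trihex from a closed 4-bar triple: if
`‖A‖ = ‖B‖ = ‖C‖ = 1` and `A + B + C = R P - P` (where `R` is rotation by 120°), then
all twelve bars of the trihex with inner vertices `x₁ = P + A`, `x₂ = P + A + B`,
`x₃ = R P + R C`, `x₄ = R P + R C + R A`, `x₅ = R²P + R²B`, `x₆ = R²P + R²B + R²C`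
have unit length.  In particular every solution of the single 4-bar closure equation
extends, by 120° rotational symmetry, to a realization of the trihex with equilateral
pinned triangle `P, R P, R²P` and all bars of unit length. -/
theorem clock_construction_all_bars_unit
    (P A B C : Plane) (hP : P ≠ 0)
    (hA : ‖A‖ = 1) (hB : ‖B‖ = 1) (hC : ‖C‖ = 1)
    (hclose : A + B + C = rot120 P - P) :
    ∀ x₁ x₂ x₃ x₄ x₅ x₆ : Plane,
      x₁ = P + A → x₂ = P + A + B →
      x₃ = rot120 P + rot120 C → x₄ = rot120 P + rot120 C + rot120 A →
      x₅ = rot120 (rot120 P) + rot120 (rot120 B) →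
      x₆ = rot120 (rot120 P) + rot120 (rot120 B) + rot120 (rot120 C) →
      ‖x₁ - P‖ = 1 ∧ ‖x₂ - x₁‖ = 1 ∧ ‖rot120 P - x₂‖ = 1 ∧
      ‖x₃ - rot120 P‖ = 1 ∧ ‖x₄ - x₃‖ = 1 ∧ ‖rot120 (rot120 P) - x₄‖ = 1 ∧
      ‖x₅ - rot120 (rot120 P)‖ = 1 ∧ ‖x₆ - x₅‖ = 1 ∧ ‖P - x₆‖ = 1 ∧
      ‖x₃ - x₂‖ = 1 ∧ ‖x₅ - x₄‖ = 1 ∧ ‖x₁ - x₆‖ = 1 := by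
  have hP' : rot120 P = A + B + C + P := by rw [hclose]; abel
  have hPP : rot120 (rot120 P) = rot120 A + rot120 B + rot120 C + rot120 P := by
    conv_lhs => rw [hP']
    simp only [rot120_add]
  have hPPP : P = rot120 (rot120 A) + rot120 (rot120 B) + rot120 (rot120 C) +
      rot120 (rot120 P) := by
    have h := congrArg rot120 hPP
    simp only [rot120_add] at h
    rw [← h, rot120_rot120 (rot120 P), rot120_rot120 P]
    abel
  rintro x₁ x₂ x₃ x₄ x₅ x₆ rfl rfl rfl rfl rfl rfl
  refine ⟨?_, ?_, ?_, ?_, ?_, ?_, ?_, ?_, ?_, ?_, ?_, ?_⟩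
  · rwa [add_sub_cancel_left]
  · rwa [add_sub_cancel_left]
  · rwa [show rot120 P - (P + A + B) = C by rw [hP']; abel]
  · rwa [add_sub_cancel_left, norm_rot120]
  · rwa [add_sub_cancel_left, norm_rot120]
  · rwa [show rot120 (rot120 P) - (rot120 P + rot120 C + rot120 A) = rot120 B by
      rw [hPP]; abel, norm_rot120]
  · rwa [add_sub_cancel_left, norm_rot120, norm_rot120]
  · rwa [add_sub_cancel_left, norm_rot120, norm_rot120]
  · rwa [show P - (rot120 (rot120 P) + rot120 (rot120 B) + rot120 (rot120 C)) =
      rot120 (rot120 A) by nth_rewrite 1 [hPPP]; abel, norm_rot120, norm_rot120]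
  · rwa [show rot120 P + rot120 C - (P + A + B) = -rot120 (rot120 C) by
      rw [hP', rot120_rot120]; abel, norm_neg, norm_rot120, norm_rot120]
  · rwa [show rot120 (rot120 P) + rot120 (rot120 B) - (rot120 P + rot120 C + rot120 A) = -B by
      rw [hPP, rot120_rot120 B]; abel, norm_neg]
  · rwa [show P + A - (rot120 (rot120 P) + rot120 (rot120 B) + rot120 (rot120 C)) =
      -rot120 A by nth_rewrite 1 [hPPP]; rw [rot120_rot120 A]; abel, norm_neg, norm_rot120]
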